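/- Fix x₀ > 0. Let ω and α be N×N complex matrix-valued kernels such that α satisfies the fundamental integral equation α(x₀,y) + ω(x₀,y) + ∫_0^{x₀} α(x₀,z)·ω(z,y) dz = 0 for all 0 < y < x₀. Let r be a kernel on (0,x₀)×(0,x₀) satisfying the resolvent equation r(z,y) + ω(z,y) + ∫_0^{x₀} r(z,s)·ω(s,y) ds = 0 for all 0 < z, y < x₀. Let f and g be N×N complex matrix-valued functions on (0,x₀], and set the perturbed kernel ω̃(z,y) := ω(z,y) + f(z)·g(y). Define g̃(y) := g(y) + ∫_0^{x₀} g(z)·r(z,y) dz, n := f(x₀) + ∫_0^{x₀} α(x₀,z)·f(z) dz, and Γ := I + ∫_0^{x₀} g̃(z)·f(z) dz, and assume the matrix Γ is invertible. Then the kernel α̃(y) := α(x₀,y) − n·Γ⁻¹·g̃(y) satisfies the perturbed fundamental integral equation α̃(y) + ω̃(x₀,y) + ∫_0^{x₀} α̃(z)·ω̃(z,y) dz = 0 for all 0 < y < x₀. -/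

import Mathlib

open MeasureTheory Set Matrix

/-- Entrywise integral of a matrix-valued function over a set of reals. -/
noncomputable def mInt {N : ℕ} (s : Set ℝ) (F : ℝ → Matrix (Fin N) (Fin N) ℂ) :
    Matrix (Fin N) (Fin N) ℂ :=
  Matrix.of fun i j => ∫ t in s, F t i j

abbrev MI {N : ℕ} (s : Set ℝ) (F : ℝ → Matrix (Fin N) (Fin N) ℂ) : Prop :=
  ∀ i j, IntegrableOn (fun t => F t i j) s

lemma mInt_add {N : ℕ} {s : Set ℝ} {F G : ℝ → Matrix (Fin N) (Fin N) ℂ}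
    (hF : MI s F) (hG : MI s G) : mInt s (fun t => F t + G t) = mInt s F + mInt s G := by
  ext i j
  simp only [mInt, Matrix.of_apply, Matrix.add_apply]
  exact integral_add (hF i j) (hG i j)

lemma MI_add {N : ℕ} {s : Set ℝ} {F G : ℝ → Matrix (Fin N) (Fin N) ℂ}
    (hF : MI s F) (hG : MI s G) : MI s (fun t => F t + G t) := by
  intro i j
  exact (hF i j).add (hG i j)

lemma MI_mul_left {N : ℕ} {s : Set ℝ} {F : ℝ → Matrix (Fin N) (Fin N) ℂ}
    (A : Matrix (Fin N) (Fin N) ℂ) (hF : MI s F) : MI s (fun t => A * F t) := by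
  intro i j
  simp only [Matrix.mul_apply]
  exact integrable_finset_sum _ fun k _ => (hF k j).const_mul _

lemma MI_mul_right {N : ℕ} {s : Set ℝ} {F : ℝ → Matrix (Fin N) (Fin N) ℂ}
    (A : Matrix (Fin N) (Fin N) ℂ) (hF : MI s F) : MI s (fun t => F t * A) := by
  intro i j
  simp only [Matrix.mul_apply]
  exact integrable_finset_sum _ fun k _ => (hF i k).mul_const _

lemma mInt_mul_left {N : ℕ} {s : Set ℝ} {F : ℝ → Matrix (Fin N) (Fin N) ℂ}
    (A : Matrix (Fin N) (Fin N) ℂ) (hF : MI s F) :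
    mInt s (fun t => A * F t) = A * mInt s F := by
  ext i j
  simp only [mInt, Matrix.of_apply, Matrix.mul_apply]
  rw [integral_finset_sum _ fun k _ => (hF k j).const_mul _]
  simp only [integral_const_mul]

lemma mInt_mul_right {N : ℕ} {s : Set ℝ} {F : ℝ → Matrix (Fin N) (Fin N) ℂ}
    (A : Matrix (Fin N) (Fin N) ℂ) (hF : MI s F) :
    mInt s (fun t => F t * A) = mInt s F * A := by
  ext i j
  simp only [mInt, Matrix.of_apply, Matrix.mul_apply]
  rw [integral_finset_sum _ fun k _ => (hF i k).mul_const _]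
  simp only [integral_mul_const]

lemma ae_Ioo (x : ℝ) : ∀ᵐ t ∂(volume.restrict (Ioc 0 x)), 0 < t ∧ t < x := by
  rw [← restrict_Ioo_eq_restrict_Ioc]
  exact (ae_restrict_mem measurableSet_Ioo)

lemma mInt_congr {N : ℕ} {x : ℝ} {F G : ℝ → Matrix (Fin N) (Fin N) ℂ}
    (h : ∀ t, 0 < t → t < x → F t = G t) : mInt (Ioc 0 x) F = mInt (Ioc 0 x) G := by
  ext i j
  simp only [mInt, Matrix.of_apply]
  refine integral_congr_ae ?_
  filter_upwards [ae_Ioo x] with t ht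
  rw [h t ht.1 ht.2]

lemma MI_congr {N : ℕ} {x : ℝ} {F G : ℝ → Matrix (Fin N) (Fin N) ℂ}
    (h : ∀ t, 0 < t → t < x → F t = G t) (hF : MI (Ioc 0 x) F) : MI (Ioc 0 x) G := by
  intro i j
  refine Integrable.congr (hF i j) ?_
  filter_upwards [ae_Ioo x] with t ht
  rw [h t ht.1 ht.2]

lemma fub {N : ℕ} {x : ℝ} {H : ℝ → ℝ → Matrix (Fin N) (Fin N) ℂ}
    (h : ∀ i j, IntegrableOn (fun p : ℝ × ℝ => H p.1 p.2 i j) (Ioc (0:ℝ) x ×ˢ Ioc (0:ℝ) x)) :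
    MI (Ioc 0 x) (fun t => mInt (Ioc 0 x) fun s => H s t) ∧
    mInt (Ioc 0 x) (fun t => mInt (Ioc 0 x) fun s => H s t) =
      mInt (Ioc 0 x) (fun s => mInt (Ioc 0 x) fun t => H s t) := by
  have h' : ∀ i j, Integrable (fun p : ℝ × ℝ => H p.1 p.2 i j)
      ((volume.restrict (Ioc 0 x)).prod (volume.restrict (Ioc 0 x))) := by
    intro i j
    rw [Measure.prod_restrict]
    exact h i j
  refine ⟨fun i j => (h' i j).integral_prod_right, ?_⟩
  ext i j
  simp only [mInt, Matrix.of_apply]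
  exact (integral_integral_swap (f := fun s t => H s t i j) (h' i j)).symm

/-- on `(0,x₀)`, the kernel `α̃ = α(x₀,·) − n Γ⁻¹ g̃` solves the perturbed
fundamental integral equation with the rank-one perturbed kernel `ω̃ = ω + f·g`. -/
theorem perturbed_fundamental_equation_on_Ioc_zero
    (N : ℕ) (hN : 0 < N) (x₀ : ℝ) (hx₀ : 0 < x₀)
    (ω α r : ℝ → ℝ → Matrix (Fin N) (Fin N) ℂ)
    (f g : ℝ → Matrix (Fin N) (Fin N) ℂ)
    (gt : ℝ → Matrix (Fin N) (Fin N) ℂ) (n Γ : Matrix (Fin N) (Fin N) ℂ)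
    -- absolute convergence of the integral in the fundamental equation
    (hfund_int : ∀ y, 0 < y → y < x₀ → ∀ i j,
      IntegrableOn (fun z => (α x₀ z * ω z y) i j) (Ioc 0 x₀))
    -- the fundamental integral equation at x₀
    (hfund : ∀ y, 0 < y → y < x₀ →
      α x₀ y + ω x₀ y + mInt (Ioc 0 x₀) (fun z => α x₀ z * ω z y) = 0)
    -- absolute convergence of the integral in the resolvent equation
    (hres_int : ∀ z y, 0 < z → z < x₀ → 0 < y → y < x₀ → ∀ i j,
      IntegrableOn (fun s => (r z s * ω s y) i j) (Ioc 0 x₀))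
    -- the resolvent equation
    (hres : ∀ z y, 0 < z → z < x₀ → 0 < y → y < x₀ →
      r z y + ω z y + mInt (Ioc 0 x₀) (fun s => r z s * ω s y) = 0)
    -- definition of g̃
    (hgt_int : ∀ y, 0 < y → y < x₀ → ∀ i j,
      IntegrableOn (fun z => (g z * r z y) i j) (Ioc 0 x₀))
    (hgt : ∀ y, 0 < y → y < x₀ → gt y = g y + mInt (Ioc 0 x₀) (fun z => g z * r z y))
    -- definition of n
    (hn_int : ∀ i j, IntegrableOn (fun z => (α x₀ z * f z) i j) (Ioc 0 x₀))
    (hn : n = f x₀ + mInt (Ioc 0 x₀) (fun z => α x₀ z * f z))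
    -- definition of Γ, assumed invertible
    (hΓ_int : ∀ i j, IntegrableOn (fun z => (gt z * f z) i j) (Ioc 0 x₀))
    (hΓ : Γ = 1 + mInt (Ioc 0 x₀) (fun z => gt z * f z))
    (hΓinv : IsUnit Γ)
    -- absolute convergence of the remaining integrals appearing
    (hgω_int : ∀ y, 0 < y → y < x₀ → ∀ i j,
      IntegrableOn (fun z => (g z * ω z y) i j) (Ioc 0 x₀))
    (hconc_int : ∀ y, 0 < y → y < x₀ → ∀ i j,
      IntegrableOn (fun z =>
        ((α x₀ z - n * Γ⁻¹ * gt z) * (ω z y + f z * g y)) i j) (Ioc 0 x₀))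
    -- absolute convergence of the iterated integrals (so orders may be interchanged)
    (hFub : ∀ y, 0 < y → y < x₀ → ∀ i j,
      IntegrableOn (fun p : ℝ × ℝ => (g p.1 * r p.1 p.2 * ω p.2 y) i j)
        ((Ioc (0:ℝ) x₀) ×ˢ (Ioc (0:ℝ) x₀))) :
    -- conclusion: the perturbed fundamental integral equation
    ∀ y, 0 < y → y < x₀ →
      (α x₀ y - n * Γ⁻¹ * gt y) + (ω x₀ y + f x₀ * g y)
        + mInt (Ioc 0 x₀) (fun z => (α x₀ z - n * Γ⁻¹ * gt z) * (ω z y + f z * g y)) = 0 := by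
  intro y hy hyx
  have hF := fub (H := fun s t => g s * r s t * ω t y) (hFub y hy hyx)
  have e1 : ∀ t, 0 < t → t < x₀ →
      mInt (Ioc 0 x₀) (fun s => g s * r s t * ω t y)
        = mInt (Ioc 0 x₀) (fun s => g s * r s t) * ω t y := fun t h1 h2 =>
    mInt_mul_right _ (hgt_int t h1 h2)
  have e2 : ∀ s, 0 < s → s < x₀ →
      mInt (Ioc 0 x₀) (fun t => g s * r s t * ω t y) = -1 * (g s * r s y + g s * ω s y) := by
    intro s h1 h2
    simp only [Matrix.mul_assoc]
    rw [mInt_mul_left _ (hres_int s y h1 h2 hy hyx),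
      eq_neg_of_add_eq_zero_right (hres s y h1 h2 hy hyx)]
    noncomm_ring
  have I1 := MI_congr e1 hF.1
  have E := hF.2
  rw [mInt_congr e1, mInt_congr e2,
    mInt_mul_left _ (MI_add (hgt_int y hy hyx) (hgω_int y hy hyx)),
    mInt_add (hgt_int y hy hyx) (hgω_int y hy hyx)] at E
  have e3 : ∀ t, 0 < t → t < x₀ →
      g t * ω t y + mInt (Ioc 0 x₀) (fun s => g s * r s t) * ω t y = gt t * ω t y := by
    intro t h1 h2
    rw [hgt t h1 h2, Matrix.add_mul]
  have I3 : MI (Ioc 0 x₀) fun t => gt t * ω t y :=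
    MI_congr e3 (MI_add (hgω_int y hy hyx) I1)
  have E3 : mInt (Ioc 0 x₀) (fun t => gt t * ω t y) = g y - gt y := by
    rw [← mInt_congr e3, mInt_add (hgω_int y hy hyx) I1, E, hgt y hy hyx]
    noncomm_ring
  have e4 : (fun z => (α x₀ z - n * Γ⁻¹ * gt z) * (ω z y + f z * g y)) = fun z =>
      (α x₀ z * ω z y + α x₀ z * f z * g y) +
      (-(n * Γ⁻¹)) * (gt z * ω z y + gt z * f z * g y) := by
    funext z
    noncomm_ring
  have A1 := hfund_int y hy hyx
  have A2 := MI_mul_right (F := fun z => α x₀ z * f z) (g y) hn_int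
  have A3 := MI_mul_right (F := fun z => gt z * f z) (g y) hΓ_int
  rw [e4, mInt_add (MI_add A1 A2) (MI_mul_left _ (MI_add I3 A3)), mInt_add A1 A2,
    mInt_mul_left _ (MI_add I3 A3), mInt_add I3 A3, E3,
    mInt_mul_right (F := fun z => α x₀ z * f z) (g y) hn_int,
    mInt_mul_right (F := fun z => gt z * f z) (g y) hΓ_int,
    eq_neg_of_add_eq_zero_right (hfund y hy hyx),
    ← sub_eq_of_eq_add' hn, ← sub_eq_of_eq_add' hΓ]
  have hG : Γ⁻¹ * Γ = 1 := Matrix.nonsing_inv_mul Γ ((Matrix.isUnit_iff_isUnit_det Γ).1 hΓinv)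
  have hG2 : n * Γ⁻¹ * (Γ * g y) = n * g y := by
    rw [Matrix.mul_assoc, ← Matrix.mul_assoc Γ⁻¹, hG, Matrix.one_mul]
  have : -(n * Γ⁻¹) * (g y - gt y + (Γ - 1) * g y) =
      n * Γ⁻¹ * gt y - n * Γ⁻¹ * (Γ * g y) := by
    generalize n * Γ⁻¹ = M
    noncomm_ring
  rw [this, hG2, Matrix.sub_mul]
  abel
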